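/- arXiv:1301.5297 — 4 statements merged into one kernel-verified Lean document; each statement's English description precedes it below -/
import Mathlib

section
/- A scattered compact Hausdorff space X is metrizable if and only if X is a continuous image of a supercompact space and all finite powers X^n, n ∈ ω, of X are hereditarily separable. -/
open Set Topology TopologicalSpace

universe u

/-- A topological space is *supercompact* if it has a subbase `S` for its topology such that
every cover of the space by members of `S` has a subcover with at most two members. -/
def IsSupercompact (X : Type*) [t : TopologicalSpace X] : Prop :=
  ∃ S : Set (Set X), TopologicalSpace.generateFrom S = t ∧
    ∀ C ⊆ S, ⋃₀ C = univ → ∃ T ⊆ C, T.Finite ∧ T.ncard ≤ 2 ∧ ⋃₀ T = univ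

/-- A topological space is *scattered* if every nonempty subspace has an isolated point. -/
def IsScatteredSpace (X : Type*) [TopologicalSpace X] : Prop :=
  ∀ A : Set X, A.Nonempty → ∃ a ∈ A, ∃ U : Set X, IsOpen U ∧ U ∩ A = {a}

/-- Every three points of a supercompact space have a median with respect to a suitable subbase:
a point all of whose subbasic neighbourhoods contain at least two of the three points. -/
theorem IsSupercompact.exists_median {Y : Type*} [t : TopologicalSpace Y]
    (hY : IsSupercompact Y) :
    ∃ S : Set (Set Y), TopologicalSpace.generateFrom S = t ∧ ∀ a b c : Y, ∃ z, ∀ σ ∈ S,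
      (a ∉ σ ∧ b ∉ σ) ∨ (a ∉ σ ∧ c ∉ σ) ∨ (b ∉ σ ∧ c ∉ σ) → z ∉ σ := by
  obtain ⟨S, hS, hcov⟩ := hY
  refine ⟨S, hS, fun a b c => ?_⟩
  by_contra! hcon
  obtain ⟨T, hTC, hTfin, hTcard, hTuniv⟩ := hcov
    {σ ∈ S | (a ∉ σ ∧ b ∉ σ) ∨ (a ∉ σ ∧ c ∉ σ) ∨ (b ∉ σ ∧ c ∉ σ)} (fun σ hσ => hσ.1)
    (eq_univ_of_forall fun z => by
      obtain ⟨σ, hσS, hσ, hz⟩ := hcon z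
      exact ⟨σ, ⟨hσS, hσ⟩, hz⟩)
  have hmem : ∀ z : Y, ∃ σ ∈ T, z ∈ σ := fun z => by
    have : z ∈ ⋃₀ T := hTuniv ▸ mem_univ z
    exact this
  obtain ⟨σ, hσT, haσ⟩ := hmem a
  have hσ := (hTC hσT).2
  obtain ⟨τ, hτT, hbτ⟩ := hmem b
  have hτ := (hTC hτT).2
  obtain ⟨ρ, hρT, hcρ⟩ := hmem c
  have hρ := (hTC hρT).2
  have h₁ : σ ≠ τ := by rintro rfl; tauto
  have h₂ : σ ≠ ρ := by rintro rfl; tauto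
  have h₃ : τ ≠ ρ := by rintro rfl; tauto
  have : (2 : ℕ) < T.ncard := (two_lt_ncard_iff hTfin).2 ⟨σ, τ, ρ, hσT, hτT, hρT, h₁, h₂, h₃⟩
  omega

theorem IsSupercompact.compactSpace {Y : Type*} [t : TopologicalSpace Y]
    (hY : IsSupercompact Y) : CompactSpace Y := by
  obtain ⟨S, hS, hcov⟩ := hY
  refine compactSpace_generateFrom hS.symm fun P hP hPu => ?_
  obtain ⟨T, hT, hfin, -, hTu⟩ := hcov P hP hPu
  exact ⟨T, hT, hfin, hTu⟩

/-- Finitely many members of a subbase separate the points of a compact open set from the points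
outside of it. -/
theorem exists_finset_subbase_separating {Y : Type*} [t : TopologicalSpace Y]
    {S : Set (Set Y)} (hS : TopologicalSpace.generateFrom S = t) {O : Set Y}
    (hO : IsOpen O) (hc : IsCompact O) :
    ∃ F : Finset (Set Y), (F : Set (Set Y)) ⊆ S ∧ ∀ w ∈ O, ∀ z ∉ O, ∃ σ ∈ F, w ∈ σ ∧ z ∉ σ := by
  classical
  refine hc.induction_on (p := fun A => ∃ F : Finset (Set Y), (F : Set (Set Y)) ⊆ S ∧
    ∀ w ∈ A, ∀ z ∉ O, ∃ σ ∈ F, w ∈ σ ∧ z ∉ σ) ⟨∅, by simp, by simp⟩ ?_ ?_ ?_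
  · rintro A B hAB ⟨F, hF, h⟩
    exact ⟨F, hF, fun w hw => h w (hAB hw)⟩
  · rintro A B ⟨F, hF, h⟩ ⟨G, hG, h'⟩
    refine ⟨F ∪ G, by simp [hF, hG], ?_⟩
    rintro w (hw | hw) z hz
    · obtain ⟨σ, hσ, h₁⟩ := h w hw z hz
      exact ⟨σ, Finset.mem_union_left _ hσ, h₁⟩
    · obtain ⟨σ, hσ, h₁⟩ := h' w hw z hz
      exact ⟨σ, Finset.mem_union_right _ hσ, h₁⟩
  · intro x hx
    obtain ⟨V, ⟨F, ⟨hFfin, hFS⟩, rfl⟩, hxV, hVO⟩ :=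
      (isTopologicalBasis_of_subbasis hS.symm).exists_subset_of_mem_open hx hO
    refine ⟨⋂₀ F, mem_nhdsWithin_of_mem_nhds (IsOpen.mem_nhds ?_ hxV), hFfin.toFinset, by simpa,
      fun w hw z hz => ?_⟩
    · exact (isTopologicalBasis_of_subbasis hS.symm).isOpen ⟨F, ⟨hFfin, hFS⟩, rfl⟩
    · have : z ∉ ⋂₀ F := fun h => hz (hVO h)
      simp only [mem_sInter, not_forall] at this
      obtain ⟨σ, hσ, hzσ⟩ := this
      exact ⟨σ, by simpa using hσ, hw σ hσ, hzσ⟩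

theorem IsScatteredSpace.totallyDisconnectedSpace {X : Type*} [TopologicalSpace X] [T1Space X]
    (h : IsScatteredSpace X) : TotallyDisconnectedSpace X := by
  refine ⟨fun A _ hA => ?_⟩
  rcases A.eq_empty_or_nonempty with rfl | hne
  · exact subsingleton_empty
  obtain ⟨a, haA, U, hU, hUA⟩ := h A hne
  intro x hx y hy
  have key : ∀ x ∈ A, x = a := by
    intro x hx
    by_contra hxa
    obtain ⟨z, hzA, hzU, hza⟩ := hA U {a}ᶜ hU isOpen_compl_singleton
      (fun z _ => by
        by_cases hz : z = a
        · left
          have : a ∈ U ∩ A := hUA ▸ mem_singleton a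
          exact hz ▸ this.1
        · exact Or.inr hz)
      ⟨a, haA, (hUA ▸ mem_singleton a : a ∈ U ∩ A).1⟩ ⟨x, hx, hxa⟩
    have : z ∈ U ∩ A := ⟨hzU, hzA⟩
    rw [hUA] at this
    exact hza this
  rw [key x hx, key y hy]

/-- A scattered space with only countably many points of local countability is countable. -/
theorem IsScatteredSpace.countable_of_countable_locallyCountable {X : Type*} [TopologicalSpace X]
    (h : IsScatteredSpace X)
    (hL : {x : X | ∃ V : Set X, IsOpen V ∧ x ∈ V ∧ V.Countable}.Countable) : Countable X := by
  set L := {x : X | ∃ V : Set X, IsOpen V ∧ x ∈ V ∧ V.Countable}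
  suffices Lᶜ = ∅ by
    rw [← countable_univ_iff, ← compl_empty_iff.1 this]
    exact hL
  by_contra hne
  obtain ⟨a, ha, U, hU, hUL⟩ := h Lᶜ (nonempty_iff_ne_empty.2 hne)
  have haU : a ∈ U ∩ Lᶜ := hUL ▸ mem_singleton a
  refine ha ⟨U, hU, haU.1, (hL.union (countable_singleton a)).mono fun z hz => ?_⟩
  by_cases hzL : z ∈ L
  · exact Or.inl hzL
  · exact Or.inr (hUL ▸ ⟨hz, hzL⟩)

/-- In a hereditarily separable space, an uncountable family of points with countable closed
neighbourhoods has a member avoided by uncountably many of these neighbourhoods. -/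
theorem exists_uncountable_notMem {X : Type*} [TopologicalSpace X]
    {U : X → Set X} {G : Set X} [SeparableSpace G] (hG : ¬ G.Countable)
    (hclosed : ∀ x ∈ G, IsClosed (U x)) (hcount : ∀ x ∈ G, (U x).Countable) :
    ∃ x ∈ G, ¬ {y ∈ G | x ∉ U y}.Countable := by
  by_contra! hcon
  obtain ⟨D, hD, hDdense⟩ := exists_countable_dense G
  have hbad : (⋃ d ∈ D, {y ∈ G | (d : X) ∉ U y}).Countable :=
    hD.biUnion fun d _ => hcon d d.2
  have hex : ∃ y ∈ G, y ∉ ⋃ d ∈ D, {y ∈ G | (d : X) ∉ U y} := by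
    by_contra! h
    exact hG (hbad.mono h)
  obtain ⟨y, hyG, hy⟩ := hex
  have hDU : D ⊆ ((↑) : G → X) ⁻¹' U y := by
    intro d hd
    by_contra hdy
    exact hy (mem_biUnion hd ⟨hyG, hdy⟩)
  have huniv : ((↑) : G → X) ⁻¹' U y = univ := by
    rw [← univ_subset_iff, ← hDdense.closure_eq]
    exact closure_minimal hDU ((hclosed y hyG).preimage continuous_subtype_val)
  refine hG ((hcount y hyG).mono fun z hz => ?_)
  have : (⟨z, hz⟩ : G) ∈ ((↑) : G → X) ⁻¹' U y := huniv ▸ mem_univ _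
  exact this

theorem exists_subset_fiber_not_countable {X β : Type*} {A : Set X} (hA : ¬ A.Countable)
    (g : X → β) {B : Set β} (hB : B.Countable) (hg : ∀ x ∈ A, g x ∈ B) :
    ∃ b ∈ B, ¬ {x ∈ A | g x = b}.Countable := by
  by_contra! h
  refine hA ((hB.biUnion h).mono fun x hx => ?_)
  exact mem_biUnion (hg x hx) ⟨hx, rfl⟩

/-- Let `n x y ∈ U x ∩ U y`, where the sets `U x` are countable. Then there are arbitrarily long
lists `l` of points outside some `U y` such that all values of `n` on `l` belong to `U y`. -/
theorem exists_list_pairwise_mem {X : Type*} {U : X → Set X} {n : X → X → X} {Z : Set X}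
    (hcount : ∀ x ∈ Z, (U x).Countable)
    (hn : ∀ x ∈ Z, ∀ y ∈ Z, n x y ∈ U x ∧ n x y ∈ U y)
    (havoid : ∀ G ⊆ Z, ¬ G.Countable → ∃ x ∈ G, ¬ {y ∈ G | x ∉ U y}.Countable) (N : ℕ) :
    ∀ G ⊆ Z, ¬ G.Countable → ∃ l : List X, ∃ y ∈ G, l.length = N ∧
      (∀ a ∈ l, a ∈ G ∧ a ∉ U y) ∧ l.Pairwise (fun a b => n a b ∈ U y) := by
  induction N with
  | zero =>
    intro G _ hG
    obtain ⟨y, hy⟩ : G.Nonempty := by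
      by_contra h
      exact hG (not_nonempty_iff_eq_empty.1 h ▸ countable_empty)
    exact ⟨[], y, hy, by simp⟩
  | succ N ih =>
    intro G hGZ hG
    obtain ⟨x, hx, hx'⟩ := havoid G hGZ hG
    obtain ⟨m, -, hm⟩ := exists_subset_fiber_not_countable hx' (n x) (hcount x (hGZ hx))
      fun y hy => (hn x (hGZ hx) y (hGZ hy.1)).1
    obtain ⟨l, y, hy, hlen, hl, hpair⟩ := ih _ (fun z hz => hGZ hz.1.1) hm
    refine ⟨x :: l, y, hy.1.1, by simp [hlen], ?_, ?_⟩
    · intro a ha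
      rcases List.mem_cons.1 ha with rfl | ha
      · exact ⟨hx, hy.1.2⟩
      · exact ⟨(hl a ha).1.1.1, (hl a ha).2⟩
    · refine List.pairwise_cons.2 ⟨fun b hb => ?_, hpair⟩
      rw [(hl b hb).1.2, ← hy.2]
      exact (hn x (hGZ hx) y (hGZ hy.1.1)).2

/-- A scattered hereditarily separable compact Hausdorff space that is a continuous image of a
supercompact space is countable. -/
theorem IsScatteredSpace.countable_of_image_of_supercompact {X Y : Type*} [TopologicalSpace X]
    [CompactSpace X] [T2Space X] [TopologicalSpace Y] (hscat : IsScatteredSpace X)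
    (hsep : ∀ A : Set X, SeparableSpace A) (hY : IsSupercompact Y) {f : Y → X}
    (hf : Continuous f) (hfs : Function.Surjective f) : Countable X := by
  classical
  have := hscat.totallyDisconnectedSpace
  have := hY.compactSpace
  obtain ⟨S, hS, hmed⟩ := hY.exists_median
  choose med hmed using hmed
  have hSopen : ∀ σ ∈ S, IsOpen σ := fun σ hσ => hS ▸ isOpen_generateFrom_of_mem hσ
  refine hscat.countable_of_countable_locallyCountable ?_
  set L := {x : X | ∃ V : Set X, IsOpen V ∧ x ∈ V ∧ V.Countable}
  by_contra hLunc
  -- countable clopen neighbourhoods and finite families separating their preimages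
  have hU : ∀ x, ∃ U : Set X, IsClopen U ∧ (x ∈ L → x ∈ U ∧ U.Countable) := by
    intro x
    by_cases hx : x ∈ L
    · obtain ⟨V, hV, hxV, hVc⟩ := hx
      obtain ⟨U, hU, hxU, hUV⟩ := compact_exists_isClopen_in_isOpen hV hxV
      exact ⟨U, hU, fun _ => ⟨hxU, hVc.mono hUV⟩⟩
    · exact ⟨∅, isClopen_empty, fun h => absurd h hx⟩
  choose U hUclopen hUL using hU
  have hF : ∀ x, ∃ F : Finset (Set Y), (F : Set (Set Y)) ⊆ S ∧
      (∀ w, f w ∈ U x → ∀ z, f z ∉ U x → ∃ σ ∈ F, w ∈ σ ∧ z ∉ σ) ∧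
      (∀ w, f w ∉ U x → ∀ z, f z ∈ U x → ∃ σ ∈ F, w ∈ σ ∧ z ∉ σ) := by
    intro x
    have hcl : IsClopen (f ⁻¹' U x) := (hUclopen x).preimage hf
    obtain ⟨F, hFS, hF⟩ := exists_finset_subbase_separating hS hcl.isOpen hcl.isClosed.isCompact
    obtain ⟨G, hGS, hG⟩ := exists_finset_subbase_separating hS hcl.compl.isOpen
      hcl.compl.isClosed.isCompact
    refine ⟨F ∪ G, by simp [hFS, hGS], fun w hw z hz => ?_, fun w hw z hz => ?_⟩
    · obtain ⟨σ, hσ, h⟩ := hF w hw z hz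
      exact ⟨σ, Finset.mem_union_left _ hσ, h⟩
    · obtain ⟨σ, hσ, h⟩ := hG w hw z (fun h => h hz)
      exact ⟨σ, Finset.mem_union_right _ hσ, h⟩
  choose F hFS hFin hFout using hF
  -- lift a countable dense subset of `X` to `Y`
  have : SeparableSpace X := by
    have := hsep univ
    exact (Homeomorph.Set.univ X).surjective.denseRange.separableSpace
      (Homeomorph.Set.univ X).continuous
  obtain ⟨D, hD, hDdense⟩ := exists_countable_dense X
  set Q := Function.surjInv hfs '' D
  have hQc : Q.Countable := hD.image _
  have hy : ∀ x, ∃ y ∈ closure Q, f y = x := by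
    intro x
    have hcl : IsClosed (f '' closure Q) := (isClosed_closure.isCompact.image hf).isClosed
    have hsub : D ⊆ f '' closure Q := fun d hd =>
      ⟨_, subset_closure (mem_image_of_mem _ hd), Function.surjInv_eq hfs d⟩
    have := closure_minimal hsub hcl
    rw [hDdense.closure_eq] at this
    exact this (mem_univ x)
  choose y hyQ hfy using hy
  have hp : ∀ x, x ∈ L → ∃ q ∈ Q, f q ∈ U x ∧ ∀ σ ∈ F x, q ∉ σ → y x ∉ σ := by
    intro x hx
    have hopen : IsOpen (f ⁻¹' U x ∩ ⋂ σ ∈ (F x).filter (y x ∈ ·), σ) :=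
      ((hUclopen x).isOpen.preimage hf).inter <| isOpen_biInter_finset fun σ hσ =>
        hSopen σ (hFS x (Finset.mem_filter.1 hσ).1)
    have hmem : y x ∈ f ⁻¹' U x ∩ ⋂ σ ∈ (F x).filter (y x ∈ ·), σ := by
      refine ⟨?_, mem_iInter₂.2 fun σ hσ => (Finset.mem_filter.1 hσ).2⟩
      rw [mem_preimage, hfy]
      exact (hUL x hx).1
    obtain ⟨q, hq, hqQ⟩ := mem_closure_iff.1 (hyQ x) _ hopen hmem
    refine ⟨q, hqQ, hq.1, fun σ hσ hqσ hyσ => hqσ ?_⟩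
    exact mem_iInter₂.1 hq.2 σ (Finset.mem_filter.2 ⟨hσ, hyσ⟩)
  have : Nonempty Y := by
    by_contra h
    rw [not_nonempty_iff] at h
    have : IsEmpty X := ⟨fun x => h.elim (y x)⟩
    exact hLunc (Set.to_countable _)
  choose! p hpQ hpU hpF using hp
  -- uncountably many points share the chosen point of `Q` and the size of the family
  obtain ⟨q, -, hZ₀⟩ := exists_subset_fiber_not_countable hLunc p hQc hpQ
  obtain ⟨k, -, hZ⟩ := exists_subset_fiber_not_countable hZ₀ (fun x => (F x).card)
    (to_countable (univ : Set ℕ)) fun x _ => mem_univ _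
  set Z := {x ∈ {x ∈ L | p x = q} | (F x).card = k}
  have hZL : Z ⊆ L := fun x hx => hx.1.1
  have hnU : ∀ a ∈ Z, ∀ b ∈ Z, f (med q (y a) (y b)) ∈ U a ∧ f (med q (y a) (y b)) ∈ U b := by
    rintro a ⟨⟨haL, rfl⟩, -⟩ b ⟨⟨hbL, hab⟩, -⟩
    constructor
    · by_contra hout
      obtain ⟨σ, hσ, h₁, h₂⟩ := hFout a _ hout _ (hpU a haL)
      exact hmed _ _ _ σ (hFS a hσ) (Or.inl ⟨h₂, hpF a haL σ hσ h₂⟩) h₁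
    · by_contra hout
      obtain ⟨σ, hσ, h₁, h₂⟩ := hFout b _ hout _ (hpU b hbL)
      have h₃ := hpF b hbL σ hσ h₂
      rw [hab] at h₂
      exact hmed _ _ _ σ (hFS b hσ) (Or.inr (Or.inl ⟨h₂, h₃⟩)) h₁
  obtain ⟨l, c, hc, hlen, hl, hpair⟩ := exists_list_pairwise_mem
    (n := fun a b => f (med q (y a) (y b))) (fun x hx => (hUL x (hZL hx)).2) hnU
    (fun G hGZ hG => by
      have := hsep G
      exact exists_uncountable_notMem hG (fun x _ => (hUclopen x).isClosed)
        fun x hx => (hUL x (hZL (hGZ hx))).2) (2 ^ k + 1) Z Subset.rfl hZ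
  have hnodup : (l.map fun a => (F c).filter (y a ∈ ·)).Nodup := by
    rw [List.Nodup, List.pairwise_map]
    refine hpair.imp_of_mem fun {a b} ha _ hab heq => ?_
    obtain ⟨σ, hσ, h₁, h₂⟩ := hFin c _ hab (y a) (by rw [hfy]; exact (hl a ha).2)
    refine hmed _ _ _ σ (hFS c hσ) (Or.inr (Or.inr ⟨h₂, fun h₃ => h₂ ?_⟩)) h₁
    have : σ ∈ (F c).filter (y a ∈ ·) := heq ▸ Finset.mem_filter.2 ⟨hσ, h₃⟩
    exact (Finset.mem_filter.1 this).2
  have hle : (l.map fun a => (F c).filter (y a ∈ ·)).toFinset.card ≤ (F c).powerset.card := by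
    refine Finset.card_le_card fun s hs => ?_
    obtain ⟨a, -, rfl⟩ := List.mem_map.1 (List.mem_toFinset.1 hs)
    exact Finset.mem_powerset.2 (Finset.filter_subset _ _)
  rw [List.toFinset_card_of_nodup hnodup, List.length_map, hlen, Finset.card_powerset, hc.2] at hle
  omega

theorem metrizableSpace_of_countable_compact {X : Type*} [TopologicalSpace X] [CompactSpace X]
    [T2Space X] [Countable X] : MetrizableSpace X := by
  have h : ∀ p : X × X, ∃ g : C(X, ℝ), p.1 ≠ p.2 → g p.1 ≠ g p.2 := by
    rintro ⟨a, b⟩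
    by_cases hab : a = b
    · exact ⟨0, fun h => absurd hab h⟩
    · obtain ⟨g, hga, hgb, -⟩ := exists_continuous_zero_one_of_isClosed
        (isClosed_singleton (x := a)) (isClosed_singleton (x := b)) (by simpa using hab)
      refine ⟨g, fun _ => ?_⟩
      simp [hga (mem_singleton a), hgb (mem_singleton b)]
  choose g hg using h
  have hcont : Continuous fun (x : X) (p : X × X) => g p x :=
    continuous_pi fun p => (g p).continuous
  have hinj : Function.Injective fun (x : X) (p : X × X) => g p x := by
    intro a b hab
    by_contra hne
    exact hg (a, b) hne (congrFun hab (a, b))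
  exact (hcont.isClosedEmbedding hinj).isEmbedding.metrizableSpace

theorem isSupercompact_ulift_cantor : IsSupercompact (ULift.{u} (ℕ → Bool)) := by
  refine ⟨{A | ∃ i b, A = {x : ULift.{u} (ℕ → Bool) | x.down i = b}}, le_antisymm ?_ ?_, ?_⟩
  · refine continuous_iff_le_induced.1 ?_
    refine @continuous_pi _ _ _ (_) _ _ fun i =>
      (@continuous_discrete_rng _ _ (_) _ _ _).2 fun b => ?_
    exact isOpen_generateFrom_of_mem ⟨i, b, rfl⟩
  · refine le_generateFrom ?_
    rintro _ ⟨i, b, rfl⟩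
    have hcont : Continuous fun x : ULift.{u} (ℕ → Bool) => x.down i :=
      (continuous_apply i).comp continuous_uliftDown
    exact (isOpen_discrete {b}).preimage hcont
  · intro C hC hCu
    have hex : ∃ i, ∀ b, {x : ULift.{u} (ℕ → Bool) | x.down i = b} ∈ C := by
      by_contra! h
      choose b hb using h
      have : (ULift.up b : ULift.{u} (ℕ → Bool)) ∈ ⋃₀ C := hCu ▸ mem_univ _
      obtain ⟨A, hA, hbA⟩ := this
      obtain ⟨i, c, rfl⟩ := hC hA
      obtain rfl : b i = c := hbA
      exact hb i hA
    obtain ⟨i, hi⟩ := hex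
    refine ⟨{{x | x.down i = true}, {x | x.down i = false}}, ?_, by simp,
      (ncard_insert_le _ _).trans (by simp), ?_⟩
    · rintro _ (rfl | rfl)
      exacts [hi true, hi false]
    · ext x
      cases hx : x.down i <;> simp [hx]

/-- A scattered compact Hausdorff space `X` is metrizable if and only if `X` is a continuous
image of a supercompact (Hausdorff) space and all finite powers `Xⁿ`, `n ∈ ω`, of `X` are
hereditarily separable. -/
theorem scattered_metrizable_iff_image_of_supercompact_and_powers_hereditarilySeparable
    (X : Type u) [TopologicalSpace X] [CompactSpace X] [T2Space X]
    (hscat : IsScatteredSpace X) :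
    TopologicalSpace.MetrizableSpace X ↔
      ((∃ (Y : Type u) (tY : TopologicalSpace Y) (f : Y → X),
          @T2Space Y tY ∧ @IsSupercompact Y tY ∧
          @Continuous Y X tY _ f ∧ Function.Surjective f) ∧
        ∀ (n : ℕ) (A : Set (Fin n → X)), TopologicalSpace.SeparableSpace A) := by
  constructor
  · intro hmet
    refine ⟨?_, fun n A => ?_⟩
    · let := metrizableSpaceMetric X
      rcases isEmpty_or_nonempty X with hX | hX
      · refine ⟨X, inferInstance, id, inferInstance, ⟨univ, ?_, fun C _ _ => ⟨∅, ?_⟩⟩,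
          continuous_id, Function.surjective_id⟩
        · exact Subsingleton.elim _ _
        · simp [Set.eq_empty_of_isEmpty]
      · obtain ⟨g, hg, hgs⟩ := exists_nat_bool_continuous_surjective_of_compact X
        exact ⟨ULift.{u} (ℕ → Bool), inferInstance, g ∘ ULift.down, inferInstance,
          isSupercompact_ulift_cantor, hg.comp continuous_uliftDown,
          hgs.comp ULift.down_surjective⟩
    · let := metrizableSpaceMetric X
      infer_instance
  · rintro ⟨⟨Y, tY, f, -, hY, hf, hfs⟩, hsep⟩
    have hsep' : ∀ A : Set X, SeparableSpace A := by
      intro A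
      have := hsep 1 ((fun x => x 0) ⁻¹' A)
      have hs : Function.Surjective (A.restrictPreimage fun x : Fin 1 → X => x 0) :=
        restrictPreimage_surjective A fun x => ⟨fun _ => x, rfl⟩
      exact hs.denseRange.separableSpace ((continuous_apply 0).restrictPreimage)
    have := hscat.countable_of_image_of_supercompact hsep' hY hf hfs
    exact metrizableSpace_of_countable_compact
end

section
/- Let X be a compact Hausdorff space containing a closed subspace Z ⊆ X such that the subspace X∖Z is discrete and Z is a retract of X (there is a continuous map r : X → Z restricting to the identity on Z). If Z is supercompact, then X is supercompact; if Z is hereditarily supercompact, then X is hereditarily supercompact. -/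
open Set Topology TopologicalSpace

universe u

/-- A topological space is *hereditarily supercompact* if each of its closed subspaces is
supercompact. -/
def IsHereditarilySupercompact (X : Type*) [TopologicalSpace X] : Prop :=
  ∀ Z : Set X, IsClosed Z → IsSupercompact Z

open Function in
/-- A section of a continuous map on a compact space whose range misses only isolated points
transfers supercompactness from the (Hausdorff) codomain to the domain. -/
theorem IsSupercompact.of_rightInverse {X K : Type*} [t : TopologicalSpace X] [CompactSpace X]
    [T1Space X] [TopologicalSpace K] [T2Space K] (hK : IsSupercompact K) {r : X → K} {i : K → X}
    (hr : Continuous r) (hri : RightInverse i r) (hiso : ∀ x ∉ range i, IsOpen {x}) :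
    IsSupercompact X := by
  obtain ⟨S, hS, hcov⟩ := hK
  have hKc : CompactSpace K := hri.surjective.compactSpace hr
  have hclosed : IsClosed (range i) := by
    rw [← isOpen_compl_iff, ← biUnion_of_singleton (range i)ᶜ]
    exact isOpen_biUnion hiso
  refine ⟨preimage r '' S ∪ ((fun x => {x}) '' (range i)ᶜ ∪ (fun x => {x}ᶜ) '' (range i)ᶜ),
    le_antisymm ?_ ?_, ?_⟩
  · set B := preimage r '' S ∪
      ((fun x => ({x} : Set X)) '' (range i)ᶜ ∪ (fun x => {x}ᶜ) '' (range i)ᶜ) with hB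
    have hrB : ∀ U : Set K, IsOpen U → IsOpen[generateFrom B] (r ⁻¹' U) := by
      have : Continuous[generateFrom B, generateFrom S] r :=
        continuous_generateFrom_iff.2 fun U hU =>
          isOpen_generateFrom_of_mem (Or.inl (mem_image_of_mem _ hU))
      rw [hS] at this
      exact fun U hU => continuous_def.1 this U hU
    intro W hW
    refine (@isOpen_iff_forall_mem_open X (generateFrom B) W).2 fun x hx => ?_
    by_cases hxi : x ∈ range i
    · obtain ⟨k, rfl⟩ := hxi
      have hF : IsClosed (r '' (range i \ W)) :=
        ((hclosed.sdiff hW).isCompact.image hr).isClosed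
      have hkF : k ∉ r '' (range i \ W) := by
        rintro ⟨_, ⟨⟨l, rfl⟩, hl⟩, h⟩
        rw [hri l] at h
        exact hl (h ▸ hx)
      obtain ⟨V, hVk, hVc, hVF⟩ := exists_mem_nhds_isClosed_subset (hF.isOpen_compl.mem_nhds hkF)
      have hE : ∀ x ∈ r ⁻¹' V \ W, x ∉ range i := fun x hxE hxi =>
        hVF hxE.1 (mem_image_of_mem r ⟨hxi, hxE.2⟩)
      have hfin : (r ⁻¹' V \ W).Finite := by
        refine ((hVc.preimage hr).sdiff hW).isCompact.finite ?_
        refine isDiscrete_iff_forall_mem_exists_isOpen.2 fun x hxE => ⟨{x}, hiso x (hE x hxE), ?_⟩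
        exact inter_eq_left.2 (singleton_subset_iff.2 hxE)
      refine ⟨r ⁻¹' interior V ∩ ⋂ x ∈ r ⁻¹' V \ W, {x}ᶜ, ?_, ?_, ?_, ?_⟩
      · rintro y ⟨hyV, hy⟩
        by_contra hyW
        exact mem_iInter₂.1 hy y ⟨interior_subset (s := V) hyV, hyW⟩ rfl
      · exact @IsOpen.inter X (generateFrom B) _ _ (hrB _ isOpen_interior)
          (@Finite.isOpen_biInter X _ (generateFrom B) _ _ hfin fun x hxE =>
            isOpen_generateFrom_of_mem (Or.inr (Or.inr (mem_image_of_mem _ (hE x hxE)))))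
      · simpa [hri k] using mem_interior_iff_mem_nhds.2 hVk
      · refine mem_iInter₂.2 fun x hxE h => hE x hxE ⟨k, h⟩
    · exact ⟨{x}, singleton_subset_iff.2 hx,
        isOpen_generateFrom_of_mem (Or.inr (Or.inl (mem_image_of_mem _ hxi))), rfl⟩
  · refine le_generateFrom ?_
    rintro _ (⟨U, hU, rfl⟩ | ⟨x, hx, rfl⟩ | ⟨x, hx, rfl⟩)
    · exact (hS ▸ isOpen_generateFrom_of_mem hU : IsOpen U).preimage hr
    · exact hiso x hx
    · exact isOpen_compl_singleton
  · intro C hC hCu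
    by_cases hx : ∃ x, {x}ᶜ ∈ C
    · obtain ⟨x, hx⟩ := hx
      obtain ⟨c, hc, hxc⟩ := mem_sUnion.1 (hCu ▸ mem_univ x)
      refine ⟨{{x}ᶜ, c}, pair_subset hx hc, toFinite _,
        (ncard_insert_le _ _).trans (by rw [ncard_singleton]), ?_⟩
      rw [sUnion_pair, eq_univ_iff_forall]
      intro y
      by_cases hy : y = x
      · exact Or.inr (hy ▸ hxc)
      · exact Or.inl hy
    · obtain ⟨T, hT, hTf, hT2, hTu⟩ := hcov {U ∈ S | r ⁻¹' U ∈ C} (fun U hU => hU.1) (by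
        refine eq_univ_iff_forall.2 fun k => ?_
        obtain ⟨c, hc, hkc⟩ := mem_sUnion.1 (hCu ▸ mem_univ (i k))
        obtain ⟨U, hU, rfl⟩ | ⟨x, hxi, rfl⟩ | ⟨x, -, rfl⟩ := hC hc
        · exact ⟨U, ⟨hU, hc⟩, by simpa [hri k] using hkc⟩
        · exact absurd ⟨k, hkc⟩ hxi
        · exact absurd ⟨x, hc⟩ hx)
      refine ⟨preimage r '' T, image_subset_iff.2 fun U hU => (hT hU).2, hTf.image _,
        (ncard_image_le hTf).trans hT2, ?_⟩
      rw [sUnion_image, ← preimage_iUnion₂, ← sUnion_eq_biUnion, hTu, preimage_univ]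

/-- Let `X` be a compact Hausdorff space with a closed subspace `Z` such that `X \ Z` is
discrete and `Z` is a retract of `X`.  If `Z` is supercompact then so is `X`, and if `Z`
is hereditarily supercompact then so is `X`. -/
theorem supercompact_of_retract_with_discrete_complement
    (X : Type u) [TopologicalSpace X] [CompactSpace X] [T2Space X]
    (Z : Set X) (hZ : IsClosed Z)
    (hdisc : DiscreteTopology (Zᶜ : Set X))
    (r : X → Z) (hr : Continuous r) (hretr : ∀ z : Z, r z = z) :
    (IsSupercompact Z → IsSupercompact X) ∧
      (IsHereditarilySupercompact Z → IsHereditarilySupercompact X) := by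
  have hiso : ∀ x ∉ Z, IsOpen {x} := fun x hx => by
    simpa using hZ.isOpen_compl.isOpenMap_subtype_val _ (isOpen_discrete {(⟨x, hx⟩ : ↥Zᶜ)})
  refine ⟨fun h => h.of_rightInverse hr (i := Subtype.val) (fun z => hretr z)
    fun x hx => hiso x (by simpa using hx), fun h Y hY => ?_⟩
  have hYc : CompactSpace Y := isCompact_iff_compactSpace.1 hY.isCompact
  have hsec : ∀ k : r '' Y, ∃ y : Y, r y = k ∧ ((k : Z).1 ∈ Y → y.1 = (k : Z).1) := by
    rintro ⟨k, y, hy, rfl⟩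
    by_cases hk : (r y).1 ∈ Y
    · exact ⟨⟨_, hk⟩, hretr _, fun _ => rfl⟩
    · exact ⟨⟨y, hy⟩, rfl, fun h => absurd h hk⟩
  choose i hi hiY using hsec
  refine (h _ (hY.isCompact.image hr).isClosed).of_rightInverse (i := i)
    (r := fun y : Y => ⟨r y, mem_image_of_mem r y.2⟩) (by fun_prop)
    (fun k => Subtype.ext (hi k)) fun y hy => ?_
  have hyZ : y.1 ∉ Z := fun hyZ => by
    have hry : r y = ⟨y, hyZ⟩ := hretr ⟨y, hyZ⟩
    refine hy ⟨⟨⟨y, hyZ⟩, y, y.2, hry⟩, Subtype.ext (hiY _ y.2)⟩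
  convert (hiso y hyZ).preimage continuous_subtype_val
  ext z
  simp [Subtype.ext_iff]
end

section
/- Let X be a nonempty Polish space without isolated points, and let K(X) denote its hyperspace of nonempty compact subsets with the Vietoris topology. Then: (1) K(X) contains a non-meager subset of cardinality non(M); (2) if cof(M) = ω₁, then K(X) contains a non-meager subset 𝒟 of cardinality ω₁ that is nwd-countable, i.e., for each nowhere dense subset F ⊆ X the set {C ∈ 𝒟 : C ∩ F ≠ ∅} is at most countable. -/
open Set Topology TopologicalSpace

universe u

/-- `non(M)`: the smallest cardinality of a non-meager subset of the real line. -/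
noncomputable def nonMeagerCard : Cardinal :=
  sInf {c : Cardinal | ∃ A : Set ℝ, ¬ IsMeagre A ∧ Cardinal.mk A = c}

/-- `cof(M)`: the smallest cardinality of a family `F` of meager subsets of the real line
such that every meager subset of `ℝ` is contained in some member of `F`. -/
noncomputable def cofMeagerCard : Cardinal :=
  sInf {c : Cardinal | ∃ F : Set (Set ℝ), (∀ A ∈ F, IsMeagre A) ∧
    (∀ B : Set ℝ, IsMeagre B → ∃ A ∈ F, B ⊆ A) ∧ Cardinal.mk F = c}

namespace HyperspaceCategory

section Transfer

variable {Y : Type*} [MetricSpace Y]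

/-- The `n`-th approximation, a centre together with a radius, to the image of a real number.
The instruction carried by `n` is obeyed when the `n`-th binary digit of `x` is odd and the
proposed ball lies inside the current one. -/
noncomputable def approx (u : ℕ → Y) : ℕ → ℝ → Y × ℝ
  | 0, _ => (u 0, 1)
  | n + 1, x =>
    open Classical in
    if Odd ⌊2 ^ n * x⌋ ∧ dist (u n.unpair.1.unpair.1) (approx u n x).1 +
        1 / ((n.unpair.1.unpair.2 : ℝ) + 1) ≤ (approx u n x).2 then
      (u n.unpair.1.unpair.1, 1 / ((n.unpair.1.unpair.2 : ℝ) + 1))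
    else approx u n x

lemma approx_radius_pos (u : ℕ → Y) (n : ℕ) (x : ℝ) : 0 < (approx u n x).2 := by
  induction n with
  | zero => simp [approx]
  | succ n ih =>
    rw [approx]
    split_ifs
    · positivity
    · exact ih

lemma dist_approx_succ (u : ℕ → Y) (n : ℕ) (x : ℝ) :
    dist (approx u (n + 1) x).1 (approx u n x).1 + (approx u (n + 1) x).2 ≤
      (approx u n x).2 := by
  rw [approx]
  split_ifs with h
  · exact h.2
  · simp

lemma dist_approx (u : ℕ → Y) (x : ℝ) {n m : ℕ} (h : n ≤ m) :
    dist (approx u m x).1 (approx u n x).1 + (approx u m x).2 ≤ (approx u n x).2 := by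
  induction m, h using Nat.le_induction with
  | base => simp
  | succ m _ ih =>
    have h₁ := dist_approx_succ u m x
    have h₂ := dist_triangle (approx u (m + 1) x).1 (approx u m x).1 (approx u n x).1
    linarith

lemma cauchySeq_approx (u : ℕ → Y) (x : ℝ) : CauchySeq fun n => (approx u n x).1 := by
  have hanti : Antitone fun n => (approx u n x).2 := fun n m h => by
    have := dist_approx u x h
    have := dist_nonneg (x := (approx u m x).1) (y := (approx u n x).1)
    simp only
    linarith
  have hbdd : BddBelow (range fun n => (approx u n x).2) :=
    ⟨0, by rintro _ ⟨n, rfl⟩; exact (approx_radius_pos u n x).le⟩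
  have hlim := tendsto_atTop_ciInf hanti hbdd
  refine cauchySeq_of_le_tendsto_0' (fun n => (approx u n x).2 - ⨅ n, (approx u n x).2)
    (fun n m h => ?_) (by simpa using hlim.sub_const (⨅ n, (approx u n x).2))
  have h₁ := dist_approx u x h
  have h₂ := ciInf_le hbdd m
  rw [dist_comm]
  linarith

lemma approx_congr (u : ℕ → Y) {x z : ℝ} {n : ℕ}
    (h : ∀ i < n, ⌊(2 : ℝ) ^ i * z⌋ = ⌊(2 : ℝ) ^ i * x⌋) : approx u n z = approx u n x := by
  induction n with
  | zero => rfl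
  | succ n ih =>
    rw [approx, approx, ih fun i hi => h i (by omega), h n (by omega)]

lemma approx_eq_of_even (u : ℕ → Y) {z : ℝ} {k n : ℕ} (hkn : k ≤ n)
    (h : ∀ i, k ≤ i → i < n → Even ⌊(2 : ℝ) ^ i * z⌋) : approx u n z = approx u k z := by
  induction n, hkn using Nat.le_induction with
  | base => rfl
  | succ n hn ih =>
    rw [approx, if_neg, ih fun i hi hi' => h i hi (by omega)]
    rw [← Int.not_even_iff_odd]
    exact fun h' => h'.1 (h n hn (by omega))

lemma floor_two_pow_mul (z : ℝ) {i n : ℕ} (h : i ≤ n) :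
    ⌊(2 : ℝ) ^ i * z⌋ = ⌊(2 : ℝ) ^ n * z⌋ / 2 ^ (n - i) := by
  have := Int.floor_div_natCast ((2 : ℝ) ^ n * z) (2 ^ (n - i))
  push_cast at this
  rw [← this]
  congr 1
  rw [eq_div_iff (by positivity), mul_right_comm, ← pow_add, Nat.add_sub_cancel' h]

/-- Every nonempty open set of reals contains a nonempty open set on which some approximation
is a ball contained in a given dense open set. -/
lemma exists_open_approx {u : ℕ → Y} (hu : DenseRange u) {O : Set Y} (hO : IsOpen O)
    (hOd : Dense O) {V : Set ℝ} (hV : IsOpen V) (hVne : V.Nonempty) :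
    ∃ W ⊆ V, IsOpen W ∧ W.Nonempty ∧
      ∃ n, ∀ z ∈ W, Metric.closedBall (approx u n z).1 (approx u n z).2 ⊆ O := by
  obtain ⟨x, hx⟩ := hVne
  obtain ⟨ε, hε, hεV⟩ := Metric.isOpen_iff.1 hV x hx
  obtain ⟨k, hk⟩ := exists_pow_lt_of_lt_one hε (show (1 / 2 : ℝ) < 1 by norm_num)
  set s := approx u (k + 1) x with hs
  have hr : 0 < s.2 := approx_radius_pos u _ x
  obtain ⟨a, ha⟩ := hu.exists_mem_open (hO.inter Metric.isOpen_ball)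
    (hOd.inter_open_nonempty _ Metric.isOpen_ball ⟨s.1, Metric.mem_ball_self hr⟩ |>.mono
      (inter_comm _ _).subset)
  obtain ⟨δ, hδ, hδO⟩ := Metric.isOpen_iff.1 hO _ ha.1
  have ha₂ : dist (u a) s.1 < s.2 := ha.2
  obtain ⟨b, hb⟩ := exists_nat_one_div_lt (lt_min hδ (sub_pos.2 ha₂))
  set N := Nat.pair (Nat.pair a b) (k + 1) with hN
  have hkN : k + 1 ≤ N := Nat.right_le_pair _ _
  set j := ⌊(2 : ℝ) ^ k * x⌋ with hj
  set J : ℤ := j * 2 ^ (N - k) + 1 with hJ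
  have key : ∀ z ∈ Ioo ((J : ℝ) / 2 ^ N) ((J + 1) / 2 ^ N), ⌊(2 : ℝ) ^ N * z⌋ = J := by
    intro z hz
    rw [Int.floor_eq_iff]
    have h2 : (0 : ℝ) < 2 ^ N := by positivity
    rw [mem_Ioo, div_lt_iff₀ h2, lt_div_iff₀ h2] at hz
    constructor <;> nlinarith [hz.1, hz.2]
  have hmid : ∀ z ∈ Ioo ((J : ℝ) / 2 ^ N) ((J + 1) / 2 ^ N), ∀ i, k ≤ i → i < N →
      ⌊(2 : ℝ) ^ i * z⌋ = j * 2 ^ (i - k) := by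
    intro z hz i hki hiN
    rw [floor_two_pow_mul z hiN.le, key z hz, hJ,
      show N - k = (i - k) + (N - i) by omega, pow_add, ← mul_assoc, add_comm,
      Int.add_mul_ediv_right _ _ (by positivity), Int.ediv_eq_zero_of_lt (by norm_num), zero_add]
    exact one_lt_pow₀ (by norm_num) (by omega)
  refine ⟨Ioo ((J : ℝ) / 2 ^ N) ((J + 1) / 2 ^ N), ?_, isOpen_Ioo, ?_, N + 1, ?_⟩
  · intro z hz
    apply hεV
    have h := hmid z hz k le_rfl (by omega)
    rw [Nat.sub_self, pow_zero, mul_one, hj] at h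
    have h' := Int.abs_sub_lt_one_of_floor_eq_floor h
    rw [← mul_sub, abs_mul, abs_of_pos (by positivity : (0 : ℝ) < 2 ^ k)] at h'
    rw [Metric.mem_ball, Real.dist_eq]
    refine lt_trans ?_ hk
    rwa [one_div, inv_pow, ← one_div, lt_div_iff₀ (by positivity), mul_comm]
  · rw [nonempty_Ioo]
    gcongr
    linarith
  · intro z hz
    have h₁ : approx u N z = s := by
      rw [approx_eq_of_even u hkN fun i hi hi' => ?_]
      · refine approx_congr u fun i hi => ?_
        rw [floor_two_pow_mul z (show i ≤ k by omega), floor_two_pow_mul x (show i ≤ k by omega),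
          hmid z hz k le_rfl (by omega)]
        simp [hj]
      · rw [hmid z hz i (by omega) hi']
        exact (even_two.pow_of_ne_zero (by omega)).mul_left _
    have h₂ : approx u (N + 1) z = (u a, 1 / ((b : ℝ) + 1)) := by
      rw [approx, h₁, key z hz, if_pos]
      · simp [hN]
      · refine ⟨?_, ?_⟩
        · exact ((even_two.pow_of_ne_zero (by omega)).mul_left _).add_one
        · have := hb.trans_le (min_le_right _ _)
          simp only [hN, Nat.unpair_pair]
          linarith
    rw [h₂]
    exact (Metric.closedBall_subset_ball (hb.trans_le (min_le_left _ _))).trans hδO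

/-- The real line maps to every nonempty Polish space so that preimages of meager sets
are meager. -/
theorem exists_preimage_isMeagre [CompleteSpace Y] [SeparableSpace Y] [Nonempty Y] :
    ∃ f : ℝ → Y, ∀ M : Set Y, IsMeagre M → IsMeagre (f ⁻¹' M) := by
  have hconv := fun x => cauchySeq_tendsto_of_complete (cauchySeq_approx (denseSeq Y) x)
  choose f hf using hconv
  have hball : ∀ x n, f x ∈
      Metric.closedBall (approx (denseSeq Y) n x).1 (approx (denseSeq Y) n x).2 := by
    intro x n
    refine Metric.isClosed_closedBall.mem_of_tendsto (hf x) ?_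
    filter_upwards [Filter.eventually_ge_atTop n] with m hm
    have := dist_approx (denseSeq Y) x hm
    have := approx_radius_pos (denseSeq Y) m x
    rw [Metric.mem_closedBall]
    linarith
  have hopen : ∀ O : Set Y, IsOpen O → Dense O → f ⁻¹' O ∈ residual ℝ := by
    intro O hO hOd
    refine Filter.mem_of_superset (residual_of_dense_open isOpen_interior ?_) interior_subset
    refine dense_iff_inter_open.2 fun V hV hVne => ?_
    obtain ⟨W, hWV, hW, ⟨z, hz⟩, n, hn⟩ :=
      exists_open_approx (denseRange_denseSeq Y) hO hOd hV hVne
    exact ⟨z, hWV hz, interior_maximal (fun w hw => hn w hw (hball w n)) hW hz⟩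
  refine ⟨f, fun M hM => ?_⟩
  obtain ⟨S, hSo, hSd, hSc, hS⟩ := mem_residual_iff.1 hM
  refine Filter.mem_of_superset
    ((countable_bInter_mem hSc).2 fun O hO => hopen O (hSo O hO) (hSd O hO)) ?_
  intro x hx
  exact hS fun O hO => by simpa using mem_iInter₂.1 hx O hO

end Transfer

lemma not_isMeagre_image {Y : Type*} [TopologicalSpace Y] {f : ℝ → Y}
    (hf : ∀ M : Set Y, IsMeagre M → IsMeagre (f ⁻¹' M)) {A : Set ℝ} (hA : ¬ IsMeagre A) :
    ¬ IsMeagre (f '' A) :=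
  fun h => hA ((hf _ h).mono (subset_preimage_image f A))

lemma exists_mk_eq_nonMeagerCard : ∃ A : Set ℝ, ¬ IsMeagre A ∧ Cardinal.mk A = nonMeagerCard :=
  csInf_mem (s := {c : Cardinal | ∃ A : Set ℝ, ¬ IsMeagre A ∧ Cardinal.mk A = c})
    ⟨_, univ, not_isMeagre_of_isOpen isOpen_univ univ_nonempty, rfl⟩

lemma isNowhereDense_singleton {X : Type*} [TopologicalSpace X] [T1Space X] {x : X}
    (hx : ¬ IsOpen ({x} : Set X)) : IsNowhereDense ({x} : Set X) := by
  rw [isClosed_singleton.isNowhereDense_iff]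
  rcases subset_singleton_iff_eq.1 (interior_subset (s := ({x} : Set X))) with h | h
  · exact h
  · exact absurd (h ▸ isOpen_interior) hx

lemma aleph0_le_nonMeagerCard : Cardinal.aleph0 ≤ nonMeagerCard := by
  obtain ⟨A, hA, hcard⟩ := exists_mk_eq_nonMeagerCard
  rw [← hcard]
  by_contra! h
  refine hA ?_
  rw [← biUnion_of_singleton A]
  exact isMeagre_biUnion (Cardinal.lt_aleph0_iff_set_finite.1 h).countable fun x _ =>
    (isNowhereDense_singleton (not_isOpen_singleton x)).isMeagre

/-- The compact sets meeting a nowhere dense set form a nowhere dense set. -/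
lemma isNowhereDense_setOf_inter_nonempty {X : Type*} [TopologicalSpace X] {F : Set X}
    (hF : IsNowhereDense F) :
    IsNowhereDense {C : NonemptyCompacts X | ((C : Set X) ∩ F).Nonempty} := by
  have hd : Dense (closure F)ᶜ := interior_eq_empty_iff_dense_compl.1 hF
  have hsub : {C : NonemptyCompacts X | ((C : Set X) ∩ F).Nonempty} ⊆
      {C : NonemptyCompacts X | ((C : Set X) ∩ closure F).Nonempty} :=
    fun C hC => Set.Nonempty.mono (inter_subset_inter_right _ subset_closure) hC
  refine IsNowhereDense.mono hsub ?_
  rw [(NonemptyCompacts.isClosed_inter_nonempty_of_isClosed isClosed_closure).isNowhereDense_iff,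
    interior_eq_empty_iff_dense_compl]
  have hfin : Dense {C : NonemptyCompacts X | (C : Set X).Finite ∧ ↑C ⊆ (closure F)ᶜ} := by
    rw [dense_iff_closure_eq, NonemptyCompacts.closure_finite_subsets, hd.closure_eq]
    simp
  refine hfin.mono ?_
  rintro C ⟨-, hC⟩ ⟨x, hxC, hxF⟩
  exact hC hxC hxF

/-- If the cofinality of the meager ideal is `ℵ₁`, there is a non-meager set of reals with at
most `ℵ₁` elements that has countable intersection with each meager set. -/
lemma exists_lusin_set (h : cofMeagerCard = Cardinal.aleph 1) :
    ∃ L : Set ℝ, ¬ IsMeagre L ∧ Cardinal.mk L ≤ Cardinal.aleph 1 ∧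
      ∀ M : Set ℝ, IsMeagre M → (L ∩ M).Countable := by
  have hne : {c : Cardinal | ∃ F : Set (Set ℝ), (∀ A ∈ F, IsMeagre A) ∧
      (∀ B : Set ℝ, IsMeagre B → ∃ A ∈ F, B ⊆ A) ∧ Cardinal.mk F = c}.Nonempty :=
    ⟨_, {A | IsMeagre A}, fun _ h => h, fun B hB => ⟨B, hB, subset_rfl⟩, rfl⟩
  obtain ⟨F, hFm, hFc, hF⟩ := csInf_mem hne
  have hF' : Cardinal.mk F = Cardinal.aleph 1 := hF.trans h
  let I := (Cardinal.aleph.{0} 1).ord.ToType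
  have hI : Cardinal.mk I = Cardinal.aleph 1 := Cardinal.mk_ord_toType _
  obtain ⟨e⟩ : Nonempty (I ≃ F) := Cardinal.eq.1 (hI.trans hF'.symm)
  have hcount : ∀ i : I, (Iic i).Countable := by
    intro i
    rw [← Iio_insert]
    refine Countable.insert _ ?_
    have hlt := (Cardinal.mk_Iio_lt i (by simp [I])).trans_eq (hI.trans Cardinal.succ_aleph0.symm)
    exact Cardinal.le_aleph0_iff_set_countable.1 (Order.lt_succ_iff.1 hlt)
  have hex : ∀ i : I, ∃ x : ℝ, x ∉ ⋃ j ∈ Iic i, (e j : Set ℝ) := by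
    intro i
    by_contra! hall
    refine not_isMeagre_of_isOpen (isOpen_univ (X := ℝ)) univ_nonempty ?_
    exact (isMeagre_biUnion (hcount i) fun j _ => hFm _ (e j).2).mono fun x _ => hall x
  choose x hx using hex
  have hlt : ∀ M : Set ℝ, IsMeagre M → ∃ i, ∀ j, x j ∈ M → j ∈ Iic i := by
    intro M hM
    obtain ⟨A, hA, hMA⟩ := hFc M hM
    refine ⟨e.symm ⟨A, hA⟩, fun j hj => ?_⟩
    by_contra hij
    have hij' : e.symm ⟨A, hA⟩ ∈ Iic j := (not_le.1 (mem_Iic.not.1 hij)).le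
    refine hx j (mem_biUnion hij' ?_)
    simpa using hMA hj
  refine ⟨range x, fun hL => ?_, Cardinal.mk_range_le.trans hI.le, fun M hM => ?_⟩
  · obtain ⟨i, hi⟩ := hlt _ hL
    have : (univ : Set I).Countable := (hcount i).mono fun j _ => hi j (mem_range_self j)
    rw [← Cardinal.le_aleph0_iff_set_countable, Cardinal.mk_univ, hI] at this
    exact absurd this (not_le.2 Cardinal.aleph0_lt_aleph_one)
  · obtain ⟨i, hi⟩ := hlt M hM
    refine ((hcount i).image x).mono ?_
    rintro _ ⟨⟨j, rfl⟩, hj⟩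
    exact mem_image_of_mem x (hi j hj)

lemma continuum_le_mk {X : Type*} [MetricSpace X] [CompleteSpace X] [Nonempty X]
    (hX : ∀ x : X, ¬ IsOpen ({x} : Set X)) : Cardinal.continuum ≤ Cardinal.mk X := by
  have hperf : Perfect (univ : Set X) := by
    refine ⟨isClosed_univ, fun x _ => ?_⟩
    rw [AccPt, Filter.principal_univ, inf_top_eq, Filter.neBot_iff]
    exact fun h => hX x ((isOpen_singleton_iff_punctured_nhds x).2 h)
  obtain ⟨g, -, -, hg⟩ := hperf.exists_nat_bool_injection univ_nonempty
  have := Cardinal.lift_mk_le_lift_mk_of_injective hg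
  simpa using this

end HyperspaceCategory

/-- Let `X` be a nonempty Polish space (here: a complete separable metric space) without
isolated points, and let `K(X)` be its hyperspace of nonempty compact subsets with the
Vietoris topology (equivalently, the Hausdorff metric topology).  Then (1) `K(X)` contains
a non-meager subset of cardinality `non(M)`, and (2) if `cof(M) = ω₁`, then `K(X)` contains
a non-meager nwd-countable subset of cardinality `ω₁` (one meeting only countably many of
its members on each nowhere dense subset of `X`). -/
theorem hyperspace_nonmeager_families
    (X : Type u) [MetricSpace X] [TopologicalSpace.SeparableSpace X] [CompleteSpace X]
    [Nonempty X] (hX : ∀ x : X, ¬ IsOpen ({x} : Set X)) :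
    (∃ S : Set (TopologicalSpace.NonemptyCompacts X), ¬ IsMeagre S ∧
        Cardinal.mk S = Cardinal.lift.{u} nonMeagerCard) ∧
      (cofMeagerCard = Cardinal.aleph 1 →
        ∃ 𝒟 : Set (TopologicalSpace.NonemptyCompacts X), ¬ IsMeagre 𝒟 ∧
          Cardinal.mk 𝒟 = Cardinal.aleph 1 ∧
          ∀ F : Set X, IsNowhereDense F →
            {C ∈ 𝒟 | ((C : Set X) ∩ F).Nonempty}.Countable) := by
  obtain ⟨f, hf⟩ := HyperspaceCategory.exists_preimage_isMeagre (Y := NonemptyCompacts X)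
  refine ⟨?_, fun hcof => ?_⟩
  · obtain ⟨A, hA, hAcard⟩ := HyperspaceCategory.exists_mk_eq_nonMeagerCard
    have hle : Cardinal.lift.{u} nonMeagerCard ≤ Cardinal.mk (NonemptyCompacts X) := by
      have h₁ : nonMeagerCard ≤ Cardinal.continuum := by
        rw [← hAcard, ← Cardinal.mk_real]
        exact Cardinal.mk_set_le A
      calc Cardinal.lift.{u} nonMeagerCard ≤ Cardinal.continuum := by simpa using h₁
        _ ≤ Cardinal.mk X := HyperspaceCategory.continuum_le_mk hX
        _ ≤ _ := Cardinal.mk_le_of_injective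
          (NonemptyCompacts.isEmbedding_singleton (α := X)).injective
    obtain ⟨T, hT⟩ := Cardinal.le_mk_iff_exists_set.1 hle
    refine ⟨f '' A ∪ T, fun h => HyperspaceCategory.not_isMeagre_image hf hA
      (h.mono subset_union_left), le_antisymm ?_ ?_⟩
    · refine (Cardinal.mk_union_le _ _).trans ?_
      rw [hT]
      refine Cardinal.add_le_of_le (by simpa using HyperspaceCategory.aleph0_le_nonMeagerCard)
        ?_ le_rfl
      simpa [hAcard] using Cardinal.mk_image_le_lift (f := f) (s := A)
    · rw [← hT]
      exact Cardinal.mk_le_mk_of_subset subset_union_right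
  · obtain ⟨L, hL, hLcard, hLc⟩ := HyperspaceCategory.exists_lusin_set hcof
    have hmeet : ∀ F : Set X, IsNowhereDense F →
        {C ∈ f '' L | ((C : Set X) ∩ F).Nonempty}.Countable := by
      intro F hF
      refine ((hLc _ (hf _
        (HyperspaceCategory.isNowhereDense_setOf_inter_nonempty hF).isMeagre)).image f).mono ?_
      rintro _ ⟨⟨x, hx, rfl⟩, hC⟩
      exact ⟨x, ⟨hx, hC⟩, rfl⟩
    have hnm := HyperspaceCategory.not_isMeagre_image hf hL
    refine ⟨f '' L, hnm, le_antisymm ?_ ?_, hmeet⟩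
    · have := Cardinal.mk_image_le_lift (f := f) (s := L)
      have h' := this.trans (Cardinal.lift_le.2 hLcard)
      simpa using h'
    · rw [← Cardinal.succ_aleph0, Order.succ_le_iff]
      by_contra! hc
      refine hnm ?_
      refine (isMeagre_biUnion (Cardinal.le_aleph0_iff_set_countable.1 hc) fun C _ =>
        (HyperspaceCategory.isNowhereDense_setOf_inter_nonempty
          (HyperspaceCategory.isNowhereDense_singleton (hX C.nonempty.some))).isMeagre).mono ?_
      exact fun C hC => mem_biUnion hC ⟨_, C.nonempty.some_mem, rfl⟩
end

section
/- Assume add(M) > ω₁. Then for every nonempty Polish space X without isolated points, every nwd-countable family 𝒞 of nonempty closed subsets of X is at most countable. -/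
open Set Topology TopologicalSpace

universe u

/-- `add(M)`: the smallest cardinality of a family of meager subsets of the real line whose
union is non-meager. -/
noncomputable def addMeagerCard : Cardinal :=
  sInf {c : Cardinal | ∃ F : Set (Set ℝ), (∀ A ∈ F, IsMeagre A) ∧
    ¬ IsMeagre (⋃₀ F) ∧ Cardinal.mk F = c}

/-- In a Hausdorff space without isolated points, every nonempty open set `V` splits into two
nonempty open pieces `W` and `V \ closure W`, where `W` may be chosen inside any prescribed
open set meeting `V`. -/
theorem exists_open_splitting {X : Type u} [TopologicalSpace X] [T2Space X]
    (hX : ∀ x : X, ¬ IsOpen ({x} : Set X)) {U V : Set X} (hU : IsOpen U) (hV : IsOpen V)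
    (hne : V.Nonempty) :
    ∃ W, IsOpen W ∧ W.Nonempty ∧ W ⊆ V ∧ (V \ closure W).Nonempty ∧
      ((V ∩ U).Nonempty → W ⊆ U) := by
  have key : ∀ O : Set X, IsOpen O → O.Nonempty →
      ∃ W, IsOpen W ∧ W.Nonempty ∧ W ⊆ O ∧ (O \ closure W).Nonempty := by
    rintro O hO ⟨x, hx⟩
    obtain ⟨y, hy, hyx⟩ : ∃ y ∈ O, y ≠ x := by
      by_contra! h
      exact hX x ((show O = {x} from eq_singleton_iff_unique_mem.2 ⟨hx, h⟩) ▸ hO)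
    obtain ⟨a, b, ha, hb, hya, hxb, hab⟩ := t2_separation hyx
    refine ⟨O ∩ b, hO.inter hb, ⟨x, hx, hxb⟩, inter_subset_left, y, hy, fun hcl => ?_⟩
    obtain ⟨z, hza, -, hzb⟩ := mem_closure_iff.1 hcl a ha hya
    exact disjoint_left.1 hab hza hzb
  by_cases h : (V ∩ U).Nonempty
  · obtain ⟨W, hW, hWne, hWs, hWd⟩ := key _ (hV.inter hU) h
    exact ⟨W, hW, hWne, hWs.trans inter_subset_left,
      hWd.mono (sdiff_subset_sdiff_left inter_subset_left), fun _ => hWs.trans inter_subset_right⟩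
  · obtain ⟨W, hW, hWne, hWs, hWd⟩ := key _ hV hne
    exact ⟨W, hW, hWne, hWs, hWd, fun h' => (h h').elim⟩

/-- The binary tree of sets obtained from `univ` by splitting a node `V` of level `n` into
`φ n V` and `V \ closure (φ n V)`. -/
def splittingTree {X : Type u} [TopologicalSpace X] (φ : ℕ → Set X → Set X) :
    List Bool → Set X
  | [] => univ
  | false :: s => φ s.length (splittingTree φ s)
  | true :: s => splittingTree φ s \ closure (φ s.length (splittingTree φ s))

/-- The left endpoint of the dyadic interval coded by a binary word, last digit first. -/
noncomputable def dyadicLeft : List Bool → ℝ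
  | [] => 0
  | false :: s => dyadicLeft s
  | true :: s => dyadicLeft s + (1 / 2) ^ (s.length + 1)

theorem dyadicLeft_append (u s : List Bool) :
    dyadicLeft s ≤ dyadicLeft (u ++ s) ∧
      dyadicLeft (u ++ s) + (1 / 2) ^ (u ++ s).length ≤ dyadicLeft s + (1 / 2) ^ s.length := by
  induction u with
  | nil => simp
  | cons b u ih =>
    obtain ⟨h₁, h₂⟩ := ih
    have h : (0 : ℝ) < (1 / 2) ^ (u ++ s).length := by positivity
    cases b <;> simp only [List.cons_append, dyadicLeft, List.length_cons, pow_succ] <;>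
      constructor <;> linarith

/-- The dyadic intervals refining a given one and containing a given point have arbitrarily
small length. -/
theorem exists_dyadic_refinement {s : List Bool} {y : ℝ}
    (hy : y ∈ Icc (dyadicLeft s) (dyadicLeft s + (1 / 2) ^ s.length)) (n : ℕ) :
    ∃ u : List Bool, u.length = n ∧
      y ∈ Icc (dyadicLeft (u ++ s)) (dyadicLeft (u ++ s) + (1 / 2) ^ (u ++ s).length) := by
  induction n with
  | zero => exact ⟨[], rfl, hy⟩
  | succ n ih =>
    obtain ⟨u, hu, h₁, h₂⟩ := ih
    have h : (0 : ℝ) < (1 / 2) ^ (u ++ s).length := by positivity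
    rcases le_total y (dyadicLeft (u ++ s) + (1 / 2) ^ ((u ++ s).length + 1)) with hle | hle
    · exact ⟨false :: u, by simp [hu], h₁, hle⟩
    · refine ⟨true :: u, by simp [hu], hle, ?_⟩
      simp only [List.cons_append, dyadicLeft, List.length_cons, pow_succ] at *
      linarith

section SplittingTree

variable {X : Type u} [TopologicalSpace X] {φ : ℕ → Set X → Set X}

theorem splittingTree_append_subset (hsub : ∀ n V, φ n V ⊆ V) (u s : List Bool) :
    splittingTree φ (u ++ s) ⊆ splittingTree φ s := by
  induction u with
  | nil => exact subset_rfl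
  | cons b u ih =>
    cases b
    · exact (hsub _ _).trans ih
    · exact sdiff_subset.trans ih

theorem eq_of_mem_splittingTree (hsub : ∀ n V, φ n V ⊆ V) {x : X} {s t : List Bool}
    (hlen : s.length = t.length) (hs : x ∈ splittingTree φ s) (ht : x ∈ splittingTree φ t) :
    s = t := by
  induction s generalizing t with
  | nil => exact (List.length_eq_zero_iff.1 hlen.symm).symm
  | cons b s ih =>
    cases t with
    | nil => simp at hlen
    | cons c t =>
      obtain rfl : s = t := ih (by simpa using hlen)
        (splittingTree_append_subset hsub [b] s hs) (splittingTree_append_subset hsub [c] t ht)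
      cases b <;> cases c
      · rfl
      · exact (ht.2 (subset_closure hs)).elim
      · exact (hs.2 (subset_closure ht)).elim
      · rfl

theorem exists_append_of_mem_splittingTree (hsub : ∀ n V, φ n V ⊆ V) {x : X} {s t : List Bool}
    (hlen : s.length ≤ t.length) (hs : x ∈ splittingTree φ s) (ht : x ∈ splittingTree φ t) :
    ∃ u, t = u ++ s := by
  have hd := List.take_append_drop (t.length - s.length) t
  have hx : x ∈ splittingTree φ (t.drop (t.length - s.length)) :=
    splittingTree_append_subset hsub (t.take (t.length - s.length)) _ (hd.symm ▸ ht)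
  have heq := eq_of_mem_splittingTree hsub (by simp; omega) hs hx
  exact ⟨t.take (t.length - s.length),
    hd.symm.trans (congrArg (t.take (t.length - s.length) ++ ·) heq.symm)⟩

/-- The real number whose binary digits code the branch of the tree through a point. -/
noncomputable def branchReal (φ : ℕ → Set X → Set X) (x : X) : ℝ :=
  sSup {r | ∃ s, x ∈ splittingTree φ s ∧ r = dyadicLeft s}

theorem branchReal_mem_Icc (hsub : ∀ n V, φ n V ⊆ V) {x : X} {s : List Bool}
    (hs : x ∈ splittingTree φ s) :
    branchReal φ x ∈ Icc (dyadicLeft s) (dyadicLeft s + (1 / 2) ^ s.length) := by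
  have hub : ∀ r ∈ {r | ∃ s, x ∈ splittingTree φ s ∧ r = dyadicLeft s},
      r ≤ dyadicLeft s + (1 / 2) ^ s.length := by
    rintro _ ⟨t, ht, rfl⟩
    have hpos : ∀ w : List Bool, (0 : ℝ) < (1 / 2) ^ w.length := fun w => by positivity
    rcases le_total s.length t.length with h | h
    · obtain ⟨u, rfl⟩ := exists_append_of_mem_splittingTree hsub h hs ht
      linarith [(dyadicLeft_append u s).2, hpos (u ++ s)]
    · obtain ⟨u, rfl⟩ := exists_append_of_mem_splittingTree hsub h ht hs
      linarith [(dyadicLeft_append u t).1, hpos (u ++ t)]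
  exact ⟨le_csSup ⟨_, hub⟩ ⟨s, hs, rfl⟩, csSup_le ⟨_, s, hs, rfl⟩ hub⟩

theorem isOpen_nonempty_splittingTree
    (hφ : ∀ n V, IsOpen V → V.Nonempty →
      IsOpen (φ n V) ∧ (φ n V).Nonempty ∧ (V \ closure (φ n V)).Nonempty)
    [Nonempty X] (s : List Bool) :
    IsOpen (splittingTree φ s) ∧ (splittingTree φ s).Nonempty := by
  induction s with
  | nil => exact ⟨isOpen_univ, univ_nonempty⟩
  | cons b s ih =>
    obtain ⟨h₁, h₂, h₃⟩ := hφ s.length _ ih.1 ih.2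
    cases b
    · exact ⟨h₁, h₂⟩
    · exact ⟨ih.1.sdiff isClosed_closure, h₃⟩

/-- The nodes of each level have dense union. -/
theorem exists_splittingTree_inter_nonempty
    {O : Set X} (hO : IsOpen O) (hne : O.Nonempty) (n : ℕ) : ∃ s : List Bool, s.length = n ∧ (splittingTree φ s ∩ O).Nonempty := by
  induction n with
  | zero => exact ⟨[], rfl, by simpa [splittingTree] using hne⟩
  | succ n ih =>
    obtain ⟨s, hs, x, hxs, hxO⟩ := ih
    by_cases h : (splittingTree φ (false :: s) ∩ O).Nonempty
    · exact ⟨false :: s, by simp [hs], h⟩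
    · refine ⟨true :: s, by simp [hs], x, ⟨hxs, fun hcl => ?_⟩, hxO⟩
      obtain ⟨z, hzO, hz⟩ := mem_closure_iff.1 hcl O hO hxO
      exact h ⟨z, hz, hzO⟩

end SplittingTree

/-- A nonempty second countable Hausdorff space without isolated points admits a real-valued
map under which preimages of nowhere dense sets are nowhere dense. -/
theorem exists_real_map_isNowhereDense_preimage (X : Type u) [TopologicalSpace X] [T2Space X]
    [SecondCountableTopology X] [Nonempty X] (hX : ∀ x : X, ¬ IsOpen ({x} : Set X)) :
    ∃ g : X → ℝ, ∀ E, IsNowhereDense E → IsNowhereDense (g ⁻¹' E) := by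
  obtain ⟨B, hB⟩ : ∃ B : ℕ → Set X, IsTopologicalBasis (range B) := by
    obtain ⟨b, hb, -⟩ := (isBasis_countableBasis X).exists_subset_of_mem_open
      (mem_univ (Classical.arbitrary X)) isOpen_univ
    obtain ⟨B, hB⟩ := (countable_countableBasis X).exists_eq_range ⟨b, hb⟩
    exact ⟨B, hB ▸ isBasis_countableBasis X⟩
  have hBo : ∀ n, IsOpen (B n) := fun n => hB.isOpen (mem_range_self n)
  have hex : ∀ (n : ℕ) (V : Set X), ∃ W, W ⊆ V ∧ (IsOpen V → V.Nonempty →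
      (IsOpen W ∧ W.Nonempty ∧ (V \ closure W).Nonempty) ∧
        ((V ∩ B n).Nonempty → W ⊆ B n)) := by
    intro n V
    by_cases h : IsOpen V ∧ V.Nonempty
    · obtain ⟨W, h₁, h₂, h₃, h₄, h₅⟩ := exists_open_splitting hX (hBo n) h.1 h.2
      exact ⟨W, h₃, fun _ _ => ⟨⟨h₁, h₂, h₄⟩, h₅⟩⟩
    · exact ⟨V, subset_rfl, fun h₁ h₂ => (h ⟨h₁, h₂⟩).elim⟩
  choose φ hsub hφ using hex
  have htree := isOpen_nonempty_splittingTree fun n V h₁ h₂ => (hφ n V h₁ h₂).1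
  refine ⟨branchReal φ, fun E hE => ?_⟩
  have avoid : ∀ O : Set X, IsOpen O → O.Nonempty →
      ∃ W ⊆ O, IsOpen W ∧ W.Nonempty ∧ Disjoint W (branchReal φ ⁻¹' E) := by
    rintro O hO ⟨x, hx⟩
    obtain ⟨_, ⟨n, rfl⟩, hxn, hnO⟩ := hB.exists_subset_of_mem_open hx hO
    obtain ⟨s, rfl, hs⟩ :=
      exists_splittingTree_inter_nonempty (hBo n) ⟨x, hxn⟩ n
    have hsO : splittingTree φ (false :: s) ⊆ O :=
      ((hφ _ _ (htree s).1 (htree s).2).2 hs).trans hnO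
    generalize false :: s = t at hsO
    have hlt : dyadicLeft t < dyadicLeft t + (1 / 2) ^ t.length :=
      lt_add_of_pos_right _ (by positivity)
    obtain ⟨y, hyI, hyE⟩ : ∃ y ∈ Ioo (dyadicLeft t) (dyadicLeft t + (1 / 2) ^ t.length),
        y ∉ closure E := by
      by_contra! h
      obtain ⟨y, hy⟩ := nonempty_Ioo.2 hlt
      have : y ∈ interior (closure E) := interior_maximal h isOpen_Ioo hy
      rw [hE] at this
      exact this
    obtain ⟨ε, hε, hball⟩ := Metric.isOpen_iff.1 isClosed_closure.isOpen_compl y hyE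
    obtain ⟨m, hm⟩ := exists_pow_lt_of_lt_one hε (show (1 / 2 : ℝ) < 1 by norm_num)
    obtain ⟨u, rfl, hyu⟩ := exists_dyadic_refinement (Ioo_subset_Icc_self hyI) m
    refine ⟨splittingTree φ (u ++ t), (splittingTree_append_subset hsub u t).trans hsO,
      (htree _).1, (htree _).2, disjoint_left.2 fun z hz hzE => ?_⟩
    have hzu := branchReal_mem_Icc hsub hz
    have hlen : ((1 / 2 : ℝ)) ^ (u ++ t).length ≤ (1 / 2) ^ u.length :=
      pow_le_pow_of_le_one (by norm_num) (by norm_num) (by simp)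
    refine hball ?_ (subset_closure hzE)
    rw [Metric.mem_ball, Real.dist_eq, abs_lt]
    constructor <;> linarith [hzu.1, hzu.2, hyu.1, hyu.2]
  rw [IsNowhereDense, ← not_nonempty_iff_eq_empty]
  intro hne
  obtain ⟨W, hWs, hW, ⟨z, hz⟩, hd⟩ := avoid _ isOpen_interior hne
  obtain ⟨w, hw, hwE⟩ := mem_closure_iff.1 (interior_subset (hWs hz)) W hW hz
  exact disjoint_left.1 hd hw hwE

/-- If `ℵ₁ < add(M)`, then every set of at most `ℵ₁` reals is meager. -/
theorem isMeagre_range_of_card_le_aleph_one (hadd : Cardinal.aleph 1 < addMeagerCard)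
    {ι : Type u} (hι : Cardinal.mk ι ≤ Cardinal.aleph 1) (f : ι → ℝ) : IsMeagre (range f) := by
  by_contra hf
  have hU : ⋃₀ range (fun i => ({f i} : Set ℝ)) = range f := by
    ext; simp [eq_comm]
  have hsing : ∀ A ∈ range (fun i => ({f i} : Set ℝ)), IsMeagre A := by
    rintro _ ⟨i, rfl⟩
    have : IsNowhereDense ({f i} : Set ℝ) := by
      rw [IsNowhereDense, closure_singleton, interior_singleton]
    exact this.isMeagre
  have hle : addMeagerCard ≤ Cardinal.mk (range fun i => ({f i} : Set ℝ)) :=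
    csInf_le' ⟨_, hsing, hU.symm ▸ hf, rfl⟩
  have hcard := Cardinal.mk_range_le_lift (f := fun i => ({f i} : Set ℝ))
  have : Cardinal.lift.{u} addMeagerCard ≤ Cardinal.lift.{u} (Cardinal.aleph.{0} 1) :=
    ((Cardinal.lift_le.2 hle).trans hcard).trans (by simpa using hι)
  exact hadd.not_ge (Cardinal.lift_le.1 this)

/-- Assume `add(M) > ω₁`.  Then for every nonempty Polish space `X` without isolated
points, every nwd-countable family `𝒞` of nonempty closed subsets of `X` (a family such
that each nowhere dense `F ⊆ X` meets only countably many members of `𝒞`) is at most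
countable. -/
theorem nwd_countable_family_countable
    (hadd : Cardinal.aleph 1 < addMeagerCard)
    (X : Type u) [TopologicalSpace X] [PolishSpace X] [Nonempty X]
    (hX : ∀ x : X, ¬ IsOpen ({x} : Set X))
    (𝒞 : Set (Set X)) (h𝒞 : ∀ C ∈ 𝒞, IsClosed C ∧ C.Nonempty)
    (hnwd : ∀ F : Set X, IsNowhereDense F → {C ∈ 𝒞 | (C ∩ F).Nonempty}.Countable) :
    𝒞.Countable := by
  by_contra hunc
  obtain ⟨𝒮, h𝒮, hcard⟩ : ∃ 𝒮 ⊆ 𝒞, Cardinal.mk 𝒮 = Cardinal.aleph 1 := by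
    refine Cardinal.le_mk_iff_exists_subset.1 ?_
    rw [← Cardinal.succ_aleph0, Order.succ_le_iff, ← not_le]
    exact fun h => hunc (Cardinal.le_aleph0_iff_set_countable.1 h)
  obtain ⟨g, hg⟩ := exists_real_map_isNowhereDense_preimage X hX
  choose p hp using fun C : 𝒮 => (h𝒞 C (h𝒮 C.2)).2
  obtain ⟨𝒩, h𝒩, h𝒩c, hcov⟩ := isMeagre_iff_countable_union_isNowhereDense.1
    (isMeagre_range_of_card_le_aleph_one hadd hcard.le fun C => g (p C))
  have hcount : 𝒮.Countable := by
    refine (h𝒩c.biUnion fun E hE => hnwd _ (hg E (h𝒩 E hE))).mono fun C hC => ?_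
    obtain ⟨E, hE, hgE⟩ := hcov (mem_range_self (⟨C, hC⟩ : 𝒮))
    exact mem_biUnion hE ⟨h𝒮 hC, p ⟨C, hC⟩, hp ⟨C, hC⟩, hgE⟩
  exact Cardinal.aleph0_lt_aleph_one.not_ge
    (hcard ▸ Cardinal.le_aleph0_iff_set_countable.2 hcount)
end
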